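/- Let m ≥ 1 be an integer, let ξ₀ < ξ₁ be reals, let β⁻, β⁺ > 0, and let J₀, J₁, J₂ : ℝ² → ℝ be smooth, with 𝓛 the associated operator. Then the set 𝒱 of all pairs (q⁻, q⁺) of real polynomials in (η,ξ) of total degree at most m satisfying the Frenet interface jump conditions (i)–(iii) is a linear subspace of ℙ_m × ℙ_m, and the projection map (q⁻, q⁺) ↦ q⁻ restricted to 𝒱 is an ℝ-linear isomorphism onto ℙ_m; in particular, 𝒱 has dimension (m+1)(m+2)/2. -/

import Mathlib

open MvPolynomial

/-- Evaluation of a bivariate polynomial at `(η, ξ)`. -/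
noncomputable def evalP (q : MvPolynomial (Fin 2) ℝ) (η ξ : ℝ) : ℝ :=
  MvPolynomial.eval ![η, ξ] q

/-- The second-order operator `𝓛 u = u_ηη + J₀ u_ξξ + J₁ u_η + J₂ u_ξ`
(the Laplacian expressed in Frenet coordinates). -/
noncomputable def Lop (J₀ J₁ J₂ : ℝ → ℝ → ℝ) (u : ℝ → ℝ → ℝ) (η ξ : ℝ) : ℝ :=
  iteratedDeriv 2 (fun t => u t ξ) η
    + J₀ η ξ * iteratedDeriv 2 (fun s => u η s) ξ
    + J₁ η ξ * deriv (fun t => u t ξ) η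
    + J₂ η ξ * deriv (fun s => u η s) ξ

/-- The Frenet interface jump conditions (i)–(iii) for a pair `(qm, qp)` of
bivariate polynomials. -/
def JumpConds (m : ℕ) (ξ₀ ξ₁ βm βp : ℝ) (J₀ J₁ J₂ : ℝ → ℝ → ℝ)
    (qm qp : MvPolynomial (Fin 2) ℝ) : Prop :=
  (∀ ξ ∈ Set.Icc ξ₀ ξ₁, evalP qp 0 ξ = evalP qm 0 ξ) ∧
  (∀ ξ ∈ Set.Icc ξ₀ ξ₁,
    βp * deriv (fun t => evalP qp t ξ) 0 = βm * deriv (fun t => evalP qm t ξ) 0) ∧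
  (∀ n : ℕ, n + 2 ≤ m → ∀ v : Polynomial ℝ, v.natDegree ≤ m - 2 - n →
    ∫ ξ in ξ₀..ξ₁, v.eval ξ *
      (βp * iteratedDeriv n (fun t => Lop J₀ J₁ J₂ (evalP qp) t ξ) 0
        - βm * iteratedDeriv n (fun t => Lop J₀ J₁ J₂ (evalP qm) t ξ) 0) = 0)

lemma hasDerivAt_evalP_left (q : MvPolynomial (Fin 2) ℝ) (η ξ : ℝ) :
    HasDerivAt (fun t => evalP q t ξ) (evalP (pderiv 0 q) η ξ) η := by
  induction q using MvPolynomial.induction_on with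
  | C a => simpa [evalP] using hasDerivAt_const η a
  | add p q hp hq => simpa [evalP] using hp.fun_add hq
  | mul_X p i hp =>
    fin_cases i
    · simpa [evalP, pderiv_X, add_comm, mul_comm] using hp.fun_mul (hasDerivAt_id η)
    · simpa [evalP, pderiv_X, add_comm, mul_comm] using hp.mul_const ξ

lemma hasDerivAt_evalP_right (q : MvPolynomial (Fin 2) ℝ) (η ξ : ℝ) :
    HasDerivAt (fun s => evalP q η s) (evalP (pderiv 1 q) η ξ) ξ := by
  induction q using MvPolynomial.induction_on with
  | C a => simpa [evalP] using hasDerivAt_const ξ a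
  | add p q hp hq => simpa [evalP] using hp.fun_add hq
  | mul_X p i hp =>
    fin_cases i
    · simpa [evalP, pderiv_X, add_comm, mul_comm] using hp.mul_const η
    · simpa [evalP, pderiv_X, add_comm, mul_comm] using hp.fun_mul (hasDerivAt_id ξ)

lemma contDiff_evalP (q : MvPolynomial (Fin 2) ℝ) {n : WithTop ℕ∞} :
    ContDiff ℝ n (Function.uncurry (evalP q)) := by
  induction q using MvPolynomial.induction_on with
  | C a => simpa [evalP, Function.uncurry_def] using contDiff_const
  | add p q hp hq => simpa [evalP, Function.uncurry_def] using hp.add hq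
  | mul_X p i hp =>
    fin_cases i
    · simpa [evalP, Function.uncurry_def] using hp.mul contDiff_fst
    · simpa [evalP, Function.uncurry_def] using hp.mul contDiff_snd

lemma Lop_evalP (J₀ J₁ J₂ : ℝ → ℝ → ℝ) (q : MvPolynomial (Fin 2) ℝ) (η ξ : ℝ) :
    Lop J₀ J₁ J₂ (evalP q) η ξ =
      evalP (pderiv 0 (pderiv 0 q)) η ξ + J₀ η ξ * evalP (pderiv 1 (pderiv 1 q)) η ξ
        + J₁ η ξ * evalP (pderiv 0 q) η ξ + J₂ η ξ * evalP (pderiv 1 q) η ξ := by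
  have h0 (p : MvPolynomial (Fin 2) ℝ) (ξ : ℝ) :
      deriv (fun t => evalP p t ξ) = fun t => evalP (pderiv 0 p) t ξ :=
    funext fun t => (hasDerivAt_evalP_left p t ξ).deriv
  have h1 (p : MvPolynomial (Fin 2) ℝ) (η : ℝ) :
      deriv (fun s => evalP p η s) = fun s => evalP (pderiv 1 p) η s :=
    funext fun s => (hasDerivAt_evalP_right p η s).deriv
  simp only [Lop, iteratedDeriv_succ, iteratedDeriv_zero, h0, h1]

lemma contDiff_Lop_evalP {J₀ J₁ J₂ : ℝ → ℝ → ℝ}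
    (hJ₀ : ContDiff ℝ (⊤ : ℕ∞) (Function.uncurry J₀))
    (hJ₁ : ContDiff ℝ (⊤ : ℕ∞) (Function.uncurry J₁))
    (hJ₂ : ContDiff ℝ (⊤ : ℕ∞) (Function.uncurry J₂)) (q : MvPolynomial (Fin 2) ℝ) :
    ContDiff ℝ (⊤ : ℕ∞) (Function.uncurry (Lop J₀ J₁ J₂ (evalP q))) := by
  have h : Function.uncurry (Lop J₀ J₁ J₂ (evalP q)) = fun x : ℝ × ℝ =>
      Function.uncurry (evalP (pderiv 0 (pderiv 0 q))) x
        + Function.uncurry J₀ x * Function.uncurry (evalP (pderiv 1 (pderiv 1 q))) x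
        + Function.uncurry J₁ x * Function.uncurry (evalP (pderiv 0 q)) x
        + Function.uncurry J₂ x * Function.uncurry (evalP (pderiv 1 q)) x :=
    funext fun x => Lop_evalP J₀ J₁ J₂ q x.1 x.2
  rw [h]
  exact (((contDiff_evalP _).add (hJ₀.mul (contDiff_evalP _))).add
    (hJ₁.mul (contDiff_evalP _))).add (hJ₂.mul (contDiff_evalP _))

lemma ContDiff.slice_left {F : ℝ → ℝ → ℝ} {n : WithTop ℕ∞}
    (hF : ContDiff ℝ n (Function.uncurry F)) (ξ : ℝ) : ContDiff ℝ n fun t => F t ξ :=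
  hF.comp (contDiff_id.prodMk contDiff_const)

lemma Continuous.slice_right {F : ℝ → ℝ → ℝ} (hF : Continuous (Function.uncurry F)) (η : ℝ) :
    Continuous fun ξ => F η ξ :=
  hF.comp (continuous_const.prodMk continuous_id)

lemma ContDiff.iteratedDeriv_left {F : ℝ → ℝ → ℝ}
    (hF : ContDiff ℝ (⊤ : ℕ∞) (Function.uncurry F)) (n : ℕ) :
    ContDiff ℝ (⊤ : ℕ∞) (Function.uncurry fun η ξ => iteratedDeriv n (fun t => F t ξ) η) := by
  induction n with
  | zero => simpa [iteratedDeriv_zero] using hF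
  | succ n ih =>
    have h : (Function.uncurry fun η ξ => iteratedDeriv (n + 1) (fun t => F t ξ) η) =
        fun x : ℝ × ℝ => fderiv ℝ
          (Function.uncurry fun η ξ => iteratedDeriv n (fun t => F t ξ) η) x (1, 0) := by
      ext ⟨η, ξ⟩
      have hd := (ih.differentiable (by simp) (η, ξ)).hasFDerivAt.comp_hasDerivAt η
        ((hasDerivAt_id η).prodMk (hasDerivAt_const η ξ))
      simp only [Function.uncurry_apply_pair, iteratedDeriv_succ]
      exact hd.deriv
    rw [h]
    exact (ih.fderiv_right (by simp)).clm_apply contDiff_const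

lemma iteratedDeriv_pow_mul_zero (n k : ℕ) {g : ℝ → ℝ} (hg : ContDiff ℝ (⊤ : ℕ∞) g) (h : n ≤ k) :
    iteratedDeriv n (fun t => t ^ k * g t) 0 = if n = k then (n.factorial : ℝ) * g 0 else 0 := by
  have hg' : ContDiffAt ℝ n g 0 := (hg.of_le (by exact_mod_cast le_top)).contDiffAt
  have hmul := iteratedDeriv_mul (n := n) (x := (0 : ℝ)) (f := fun t : ℝ => t ^ k)
    (contDiff_id.pow k).contDiffAt hg'
  change iteratedDeriv n ((fun t : ℝ => t ^ k) * g) 0 = _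
  rw [hmul]
  simp only [iteratedDeriv_fun_pow_zero]
  split_ifs with hk
  · subst hk
    rw [Finset.sum_eq_single n]
    · simp
    · intro i _ hi
      simp [hi]
    · simp
  · refine Finset.sum_eq_zero fun i hi => ?_
    have : i ≠ k := by have := Finset.mem_range.1 hi; omega
    simp [this]

/-- The Taylor-type data of a polynomial on the interface `η = 0`: its trace, its normal
derivative, and the normal derivatives of its image under `𝓛`. -/
noncomputable def interfaceData (J₀ J₁ J₂ : ℝ → ℝ → ℝ) (q : MvPolynomial (Fin 2) ℝ) :
    ℕ → ℝ → ℝ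
  | 0, ξ => evalP q 0 ξ
  | 1, ξ => deriv (fun t => evalP q t ξ) 0
  | n + 2, ξ => iteratedDeriv n (fun t => Lop J₀ J₁ J₂ (evalP q) t ξ) 0

section interfaceData

variable {J₀ J₁ J₂ : ℝ → ℝ → ℝ}
    (hJ₀ : ContDiff ℝ (⊤ : ℕ∞) (Function.uncurry J₀))
    (hJ₁ : ContDiff ℝ (⊤ : ℕ∞) (Function.uncurry J₁))
    (hJ₂ : ContDiff ℝ (⊤ : ℕ∞) (Function.uncurry J₂))

lemma interfaceData_one (J₀ J₁ J₂ : ℝ → ℝ → ℝ) (q : MvPolynomial (Fin 2) ℝ) (ξ : ℝ) :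
    interfaceData J₀ J₁ J₂ q 1 ξ = evalP (pderiv 0 q) 0 ξ :=
  (hasDerivAt_evalP_left q 0 ξ).deriv

include hJ₀ hJ₁ hJ₂

lemma continuous_interfaceData (q : MvPolynomial (Fin 2) ℝ) (i : ℕ) :
    Continuous (interfaceData J₀ J₁ J₂ q i) := by
  match i with
  | 0 => exact (contDiff_evalP (n := 0) q).continuous.slice_right 0
  | 1 =>
    exact ((contDiff_evalP (n := 0) (pderiv 0 q)).continuous.slice_right 0).congr fun ξ =>
      (interfaceData_one J₀ J₁ J₂ q ξ).symm
  | n + 2 =>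
    exact ((contDiff_Lop_evalP hJ₀ hJ₁ hJ₂ q).iteratedDeriv_left n).continuous.slice_right 0

lemma contDiffAt_Lop_evalP (q : MvPolynomial (Fin 2) ℝ) (n : ℕ) (ξ : ℝ) :
    ContDiffAt ℝ n (fun t => Lop J₀ J₁ J₂ (evalP q) t ξ) 0 :=
  (((contDiff_Lop_evalP hJ₀ hJ₁ hJ₂ q).slice_left ξ).of_le
    (by exact_mod_cast le_top)).contDiffAt

lemma interfaceData_add (p q : MvPolynomial (Fin 2) ℝ) (i : ℕ) (ξ : ℝ) :
    interfaceData J₀ J₁ J₂ (p + q) i ξ =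
      interfaceData J₀ J₁ J₂ p i ξ + interfaceData J₀ J₁ J₂ q i ξ := by
  match i with
  | 0 => simp [interfaceData, evalP]
  | 1 => simp [interfaceData_one, evalP]
  | n + 2 =>
    simp only [interfaceData]
    rw [← iteratedDeriv_fun_add (contDiffAt_Lop_evalP hJ₀ hJ₁ hJ₂ p n ξ)
      (contDiffAt_Lop_evalP hJ₀ hJ₁ hJ₂ q n ξ)]
    congr 1
    ext t
    simp only [Lop_evalP, evalP, map_add]
    ring

omit hJ₀ hJ₁ hJ₂ in
lemma interfaceData_smul (c : ℝ) (q : MvPolynomial (Fin 2) ℝ) (i : ℕ) (ξ : ℝ) :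
    interfaceData J₀ J₁ J₂ (c • q) i ξ = c * interfaceData J₀ J₁ J₂ q i ξ := by
  match i with
  | 0 => simp [interfaceData, evalP]
  | 1 => simp [interfaceData_one, evalP]
  | n + 2 =>
    simp only [interfaceData]
    rw [← iteratedDeriv_const_mul_field]
    congr 1
    ext t
    simp only [Lop_evalP, evalP, Derivation.map_smul, smul_eval]
    ring

omit hJ₀ hJ₁ hJ₂ in
lemma iteratedDeriv_evalP_pderiv_pderiv (q : MvPolynomial (Fin 2) ℝ) (n : ℕ) (ξ : ℝ) :
    iteratedDeriv n (fun t => evalP (pderiv 0 (pderiv 0 q)) t ξ) =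
      iteratedDeriv (n + 2) fun t => evalP q t ξ := by
  have h0 (p : MvPolynomial (Fin 2) ℝ) :
      deriv (fun t => evalP p t ξ) = fun t => evalP (pderiv 0 p) t ξ :=
    funext fun t => (hasDerivAt_evalP_left p t ξ).deriv
  rw [iteratedDeriv_succ', iteratedDeriv_succ', h0, h0]

omit hJ₀ hJ₁ hJ₂ in
lemma Lop_evalP_X_pow_mul (r : MvPolynomial (Fin 2) ℝ) (n : ℕ) (t ξ : ℝ) :
    Lop J₀ J₁ J₂ (evalP (X 0 ^ (n + 2) * r)) t ξ =
      evalP (pderiv 0 (pderiv 0 (X 0 ^ (n + 2) * r))) t ξ + t ^ (n + 1) *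
        (J₀ t ξ * (t * evalP (pderiv 1 (pderiv 1 r)) t ξ)
        + J₁ t ξ * ((n + 2) * evalP r t ξ + t * evalP (pderiv 0 r) t ξ)
        + J₂ t ξ * (t * evalP (pderiv 1 r) t ξ)) := by
  have h1 (p : MvPolynomial (Fin 2) ℝ) :
      pderiv 1 (X 0 ^ (n + 2) * p) = X 0 ^ (n + 2) * pderiv 1 p := by
    simp [Derivation.leibniz, Derivation.leibniz_pow,
      pderiv_X_of_ne (show (0 : Fin 2) ≠ 1 by decide)]
  have h0 : evalP (pderiv 0 (X 0 ^ (n + 2) * r)) t ξ =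
      t ^ (n + 1) * ((n + 2) * evalP r t ξ + t * evalP (pderiv 0 r) t ξ) := by
    simp [evalP, Derivation.leibniz, Derivation.leibniz_pow]
    ring
  rw [Lop_evalP, h1, h1, h0]
  simp only [evalP, map_mul, map_pow, eval_X, Matrix.cons_val_zero]
  ring

lemma interfaceData_X_pow_mul (r : MvPolynomial (Fin 2) ℝ) (i : ℕ) (ξ : ℝ) :
    interfaceData J₀ J₁ J₂ (X 0 ^ i * r) i ξ = i.factorial * evalP r 0 ξ := by
  have hs (p : MvPolynomial (Fin 2) ℝ) : ContDiff ℝ (⊤ : ℕ∞) fun t => evalP p t ξ :=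
    (contDiff_evalP p).slice_left ξ
  match i with
  | 0 => simp [interfaceData]
  | 1 => simp [interfaceData_one, evalP]
  | n + 2 =>
    have hA : iteratedDeriv n (fun t => evalP (pderiv 0 (pderiv 0 (X 0 ^ (n + 2) * r))) t ξ) 0 =
        (n + 2).factorial * evalP r 0 ξ := by
      have hpow : (fun t => evalP (X 0 ^ (n + 2) * r) t ξ) = fun t => t ^ (n + 2) * evalP r t ξ := by
        simp [evalP]
      rw [iteratedDeriv_evalP_pderiv_pderiv, hpow,
        iteratedDeriv_pow_mul_zero _ _ (hs r) le_rfl, if_pos rfl]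
    let g : ℝ → ℝ := fun t =>
      J₀ t ξ * (t * evalP (pderiv 1 (pderiv 1 r)) t ξ)
        + J₁ t ξ * ((n + 2) * evalP r t ξ + t * evalP (pderiv 0 r) t ξ)
        + J₂ t ξ * (t * evalP (pderiv 1 r) t ξ)
    have hg : ContDiff ℝ (⊤ : ℕ∞) g := by
      have := hJ₀.slice_left ξ
      have := hJ₁.slice_left ξ
      have := hJ₂.slice_left ξ
      have := hs (pderiv 1 (pderiv 1 r))
      have := hs (pderiv 0 r)
      have := hs (pderiv 1 r)
      have := hs r
      fun_prop
    have hL : (fun t => Lop J₀ J₁ J₂ (evalP (X 0 ^ (n + 2) * r)) t ξ) = fun t =>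
        evalP (pderiv 0 (pderiv 0 (X 0 ^ (n + 2) * r))) t ξ + t ^ (n + 1) * g t :=
      funext fun t => Lop_evalP_X_pow_mul r n t ξ
    simp only [interfaceData]
    rw [hL, iteratedDeriv_fun_add, hA, iteratedDeriv_pow_mul_zero _ _ hg (by omega)]
    · simp
    · exact ((hs _).of_le (by exact_mod_cast le_top)).contDiffAt
    · exact (((contDiff_id.pow _).mul hg).of_le (by exact_mod_cast le_top)).contDiffAt

end interfaceData

/-- The restriction of a bivariate polynomial to the interface `η = 0`. -/
noncomputable def interfaceTrace : MvPolynomial (Fin 2) ℝ →ₐ[ℝ] Polynomial ℝ :=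
  aeval ![0, Polynomial.X]

lemma eval_interfaceTrace (q : MvPolynomial (Fin 2) ℝ) (ξ : ℝ) :
    (interfaceTrace q).eval ξ = evalP q 0 ξ := by
  induction q using MvPolynomial.induction_on with
  | C a => simp [interfaceTrace, evalP]
  | add p q hp hq => simp_all [evalP]
  | mul_X p i hp =>
    rw [map_mul, Polynomial.eval_mul, hp]
    fin_cases i <;> simp [interfaceTrace, evalP]

lemma natDegree_interfaceTrace_le {q : MvPolynomial (Fin 2) ℝ} {m : ℕ} (hq : q.totalDegree ≤ m) :
    (interfaceTrace q).natDegree ≤ m := by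
  have h := aeval_natDegree_le (n := 1) q hq ![0, Polynomial.X] fun i => by
    fin_cases i <;> simp
  simpa [interfaceTrace] using h

lemma X_zero_dvd_of_interfaceTrace_eq_zero {q : MvPolynomial (Fin 2) ℝ}
    (hq : interfaceTrace q = 0) : X 0 ∣ q := by
  have key (p : MvPolynomial (Fin 2) ℝ) :
      (X 0 : MvPolynomial (Fin 2) ℝ) ∣ p - Polynomial.aeval (X 1) (interfaceTrace p) := by
    induction p using MvPolynomial.induction_on with
    | C a => simp [interfaceTrace, algebraMap_eq]
    | add p q hp hq =>
      rw [map_add, map_add, add_sub_add_comm]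
      exact dvd_add hp hq
    | mul_X p i hp =>
      fin_cases i
      · simp [interfaceTrace]
      · have : p * X 1 - Polynomial.aeval (X 1) (interfaceTrace (p * X 1)) =
            (p - Polynomial.aeval (X 1) (interfaceTrace p)) * X 1 := by
          simp [interfaceTrace, sub_mul]
        exact this ▸ hp.mul_right _
  simpa [hq] using key q

lemma totalDegree_pderiv_le_sub_one {σ R : Type*} [CommSemiring R] (i : σ) (p : MvPolynomial σ R) :
    (pderiv i p).totalDegree ≤ p.totalDegree - 1 := by
  rw [totalDegree, Finset.sup_le_iff]
  intro s hs
  have hs' : s + Finsupp.single i 1 ∈ p.support := by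
    rw [mem_support_iff, coeff_pderiv] at hs
    exact mem_support_iff.2 (left_ne_zero_of_mul hs)
  have h := le_totalDegree hs'
  rw [Finsupp.sum_add_index' (by simp) (by simp), Finsupp.sum_single_index rfl] at h
  omega

lemma finrank_restrictTotalDegree_fin_two (R : Type*) [CommRing R] [Nontrivial R] (m : ℕ) :
    Module.finrank R (restrictTotalDegree (Fin 2) R m) = ∑ i : Fin (m + 1), (m - i + 1) := by
  have e : {n : Fin 2 →₀ ℕ | (n.sum fun _ e => e) ≤ m} ≃ Σ i : Fin (m + 1), Fin (m - i + 1) :=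
    { toFun := fun n => ⟨⟨n.1 0, by
          have := n.2; simp [Finsupp.sum_fintype] at this; omega⟩, ⟨n.1 1, by
          have := n.2; simp [Finsupp.sum_fintype] at this ⊢; omega⟩⟩
      invFun := fun x => ⟨Finsupp.equivFunOnFinite.symm ![x.1, x.2], by
          have := x.1.2; have := x.2.2; simp [Finsupp.sum_fintype]; omega⟩
      left_inv := fun n => by
        ext i
        fin_cases i <;> simp
      right_inv := fun x => by simp }
  have b : Module.Basis _ R (restrictTotalDegree (Fin 2) R m) := basisRestrictSupport R _
  rw [Module.finrank_eq_nat_card_basis b, Nat.card_congr e]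
  simp

lemma sum_fin_sub_add_one (m : ℕ) :
    ∑ i : Fin (m + 1), (m - i + 1) = (m + 1) * (m + 2) / 2 := by
  have h := Finset.sum_range_reflect (fun i => i + 1) (m + 1)
  have h' := Finset.sum_range_succ' (fun i => i) (m + 1)
  rw [Finset.sum_range_id] at h'
  simp only [Nat.add_sub_cancel, add_zero] at h h'
  rw [Fin.sum_univ_eq_sum_range fun i => m - i + 1, h, ← h', mul_comm]

lemma Polynomial.mem_degreeLT_succ {R : Type*} [Semiring R] {p : Polynomial R} {n : ℕ} :
    p ∈ Polynomial.degreeLT R (n + 1) ↔ p.natDegree ≤ n := by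
  rw [Polynomial.degreeLT_succ_eq_degreeLE, Polynomial.mem_degreeLE,
    Polynomial.natDegree_le_iff_degree_le]

lemma Polynomial.eq_zero_of_integral_mul_self {a b : ℝ} (hab : a < b) {p : Polynomial ℝ}
    (h : ∫ x in a..b, p.eval x * p.eval x = 0) : p = 0 := by
  refine p.eq_zero_of_infinite_isRoot ((Set.Icc_infinite hab).mono fun x hx => ?_)
  by_contra hne
  refine (intervalIntegral.integral_pos hab (by fun_prop) (fun y _ => mul_self_nonneg (p.eval y))
    ⟨x, hx, mul_self_pos.2 hne⟩).ne' h

section moments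

variable {J₀ J₁ J₂ : ℝ → ℝ → ℝ}

/-- The moments against polynomials of degree at most `m - i` of the `i`-th interface datum of a
polynomial, weighted by `β` for `i ≠ 0`. -/
noncomputable def interfaceMoments (ξ₀ ξ₁ : ℝ)
    (hJ₀ : ContDiff ℝ (⊤ : ℕ∞) (Function.uncurry J₀))
    (hJ₁ : ContDiff ℝ (⊤ : ℕ∞) (Function.uncurry J₁))
    (hJ₂ : ContDiff ℝ (⊤ : ℕ∞) (Function.uncurry J₂)) (m : ℕ) (β : ℝ) :
    MvPolynomial (Fin 2) ℝ →ₗ[ℝ]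
      ((i : Fin (m + 1)) → Module.Dual ℝ (Polynomial.degreeLT ℝ (m - i + 1))) :=
  LinearMap.pi fun i => LinearMap.mk₂ ℝ
    (fun q v => ∫ ξ in ξ₀..ξ₁, (v : Polynomial ℝ).eval ξ *
      ((if (i : ℕ) = 0 then 1 else β) * interfaceData J₀ J₁ J₂ q i ξ))
    (fun p q v => by
      have hp := continuous_interfaceData hJ₀ hJ₁ hJ₂ p i
      have hq := continuous_interfaceData hJ₀ hJ₁ hJ₂ q i
      rw [← intervalIntegral.integral_add (Continuous.intervalIntegrable (by fun_prop) _ _)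
        (Continuous.intervalIntegrable (by fun_prop) _ _)]
      congr 1
      ext ξ
      rw [interfaceData_add hJ₀ hJ₁ hJ₂]
      ring)
    (fun c q v => by
      rw [smul_eq_mul, ← intervalIntegral.integral_const_mul]
      congr 1
      ext ξ
      rw [interfaceData_smul]
      ring)
    (fun q v w => by
      have hq := continuous_interfaceData hJ₀ hJ₁ hJ₂ q i
      rw [← intervalIntegral.integral_add (Continuous.intervalIntegrable (by fun_prop) _ _)
        (Continuous.intervalIntegrable (by fun_prop) _ _)]
      congr 1
      ext ξ
      rw [Submodule.coe_add, Polynomial.eval_add]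
      ring)
    (fun c q v => by
      rw [smul_eq_mul, ← intervalIntegral.integral_const_mul]
      congr 1
      ext ξ
      rw [Submodule.coe_smul, Polynomial.eval_smul, smul_eq_mul]
      ring)

variable {ξ₀ ξ₁ : ℝ}
    (hJ₀ : ContDiff ℝ (⊤ : ℕ∞) (Function.uncurry J₀))
    (hJ₁ : ContDiff ℝ (⊤ : ℕ∞) (Function.uncurry J₁))
    (hJ₂ : ContDiff ℝ (⊤ : ℕ∞) (Function.uncurry J₂))

lemma interfaceMoments_apply (m : ℕ) (β : ℝ) (q : MvPolynomial (Fin 2) ℝ) (i : Fin (m + 1))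
    (v : Polynomial.degreeLT ℝ (m - i + 1)) :
    interfaceMoments ξ₀ ξ₁ hJ₀ hJ₁ hJ₂ m β q i v = ∫ ξ in ξ₀..ξ₁, (v : Polynomial ℝ).eval ξ *
      ((if (i : ℕ) = 0 then 1 else β) * interfaceData J₀ J₁ J₂ q i ξ) :=
  rfl

lemma interfaceMoments_eq_iff (m : ℕ) (βm βp : ℝ) (qm qp : MvPolynomial (Fin 2) ℝ) :
    interfaceMoments ξ₀ ξ₁ hJ₀ hJ₁ hJ₂ m βp qp = interfaceMoments ξ₀ ξ₁ hJ₀ hJ₁ hJ₂ m βm qm ↔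
      ∀ i ≤ m, ∀ v : Polynomial ℝ, v.natDegree ≤ m - i →
        ∫ ξ in ξ₀..ξ₁, v.eval ξ *
          ((if i = 0 then 1 else βp) * interfaceData J₀ J₁ J₂ qp i ξ
            - (if i = 0 then 1 else βm) * interfaceData J₀ J₁ J₂ qm i ξ) = 0 := by
  have key (i : ℕ) (v : Polynomial ℝ) : ∫ ξ in ξ₀..ξ₁, v.eval ξ *
      ((if i = 0 then 1 else βp) * interfaceData J₀ J₁ J₂ qp i ξ
        - (if i = 0 then 1 else βm) * interfaceData J₀ J₁ J₂ qm i ξ) =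
      (∫ ξ in ξ₀..ξ₁, v.eval ξ * ((if i = 0 then 1 else βp) * interfaceData J₀ J₁ J₂ qp i ξ)) -
      ∫ ξ in ξ₀..ξ₁, v.eval ξ * ((if i = 0 then 1 else βm) * interfaceData J₀ J₁ J₂ qm i ξ) := by
    have hp := continuous_interfaceData hJ₀ hJ₁ hJ₂ qp i
    have hq := continuous_interfaceData hJ₀ hJ₁ hJ₂ qm i
    rw [← intervalIntegral.integral_sub (Continuous.intervalIntegrable (by fun_prop) _ _)
      (Continuous.intervalIntegrable (by fun_prop) _ _)]
    simp only [mul_sub]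
  simp only [key, sub_eq_zero]
  constructor
  · intro h i hi v hv
    exact LinearMap.congr_fun (congrFun h ⟨i, by omega⟩) ⟨v, Polynomial.mem_degreeLT_succ.2 hv⟩
  · intro h
    funext i
    ext v
    exact h i (by omega) v (Polynomial.mem_degreeLT_succ.1 v.2)

lemma integral_mul_eval_eq_zero_iff (hξ : ξ₀ < ξ₁) {f : ℝ → ℝ} {p : Polynomial ℝ} {k : ℕ}
    (hp : p.natDegree ≤ k) (hf : ∀ ξ, f ξ = p.eval ξ) :
    (∀ v : Polynomial ℝ, v.natDegree ≤ k → ∫ ξ in ξ₀..ξ₁, v.eval ξ * f ξ = 0) ↔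
      ∀ ξ ∈ Set.Icc ξ₀ ξ₁, f ξ = 0 := by
  simp only [hf]
  constructor
  · intro h ξ _
    simp [Polynomial.eq_zero_of_integral_mul_self hξ (h p hp)]
  · intro h v _
    refine (intervalIntegral.integral_congr (g := fun _ => 0) fun ξ hx => ?_).trans (by simp)
    rw [Set.uIcc_of_le hξ.le] at hx
    simp [h ξ hx]

lemma jumpConds_iff {m : ℕ} (hm : 1 ≤ m) (hξ : ξ₀ < ξ₁) (βm βp : ℝ)
    {qm qp : MvPolynomial (Fin 2) ℝ} (hqm : qm.totalDegree ≤ m) (hqp : qp.totalDegree ≤ m) :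
    JumpConds m ξ₀ ξ₁ βm βp J₀ J₁ J₂ qm qp ↔
      interfaceMoments ξ₀ ξ₁ hJ₀ hJ₁ hJ₂ m βp qp =
        interfaceMoments ξ₀ ξ₁ hJ₀ hJ₁ hJ₂ m βm qm := by
  have h0 := integral_mul_eval_eq_zero_iff hξ
    (f := fun ξ => evalP qp 0 ξ - evalP qm 0 ξ) (p := interfaceTrace qp - interfaceTrace qm)
    (k := m) ((Polynomial.natDegree_sub_le _ _).trans
      (max_le (natDegree_interfaceTrace_le hqp) (natDegree_interfaceTrace_le hqm)))
    (fun ξ => by simp [eval_interfaceTrace])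
  have hd {q : MvPolynomial (Fin 2) ℝ} (hq : q.totalDegree ≤ m) (β : ℝ) :
      (Polynomial.C β * interfaceTrace (pderiv 0 q)).natDegree ≤ m - 1 :=
    (Polynomial.natDegree_C_mul_le _ _).trans (natDegree_interfaceTrace_le
      ((totalDegree_pderiv_le_sub_one 0 q).trans (by omega)))
  have h1 := integral_mul_eval_eq_zero_iff hξ
    (f := fun ξ => βp * interfaceData J₀ J₁ J₂ qp 1 ξ - βm * interfaceData J₀ J₁ J₂ qm 1 ξ)
    (p := Polynomial.C βp * interfaceTrace (pderiv 0 qp)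
      - Polynomial.C βm * interfaceTrace (pderiv 0 qm))
    (k := m - 1) ((Polynomial.natDegree_sub_le _ _).trans (max_le (hd hqp βp) (hd hqm βm)))
    (fun ξ => by simp [eval_interfaceTrace, interfaceData_one])
  rw [interfaceMoments_eq_iff]
  simp only [sub_eq_zero, interfaceData] at h0 h1
  constructor
  · rintro ⟨hi, hii, hiii⟩ i hi' v hv
    match i with
    | 0 => simpa [interfaceData] using h0.2 hi v hv
    | 1 => simpa [interfaceData] using h1.2 hii v hv
    | n + 2 => simpa [interfaceData] using hiii n hi' v (by omega)
  · intro h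
    refine ⟨h0.1 fun v hv => ?_, h1.1 fun v hv => ?_, fun n hn v hv => ?_⟩
    · simpa [interfaceData] using h 0 (by omega) v hv
    · simpa [interfaceData] using h 1 hm v hv
    · simpa [interfaceData] using h (n + 2) hn v (by omega)

lemma eq_zero_of_interfaceMoments_eq_zero {m : ℕ} (hξ : ξ₀ < ξ₁) {β : ℝ} (hβ : β ≠ 0)
    {q : MvPolynomial (Fin 2) ℝ} (hq : q.totalDegree ≤ m)
    (h : interfaceMoments ξ₀ ξ₁ hJ₀ hJ₁ hJ₂ m β q = 0) : q = 0 := by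
  by_contra hne
  have hdeg {i : ℕ} {r : MvPolynomial (Fin 2) ℝ} (hr : q = X 0 ^ i * r) :
      i + r.totalDegree ≤ m := by
    have hr0 : r ≠ 0 := by
      rintro rfl
      exact hne (by simpa using hr)
    rwa [hr, totalDegree_mul_of_isDomain (pow_ne_zero _ (X_ne_zero _)) hr0,
      totalDegree_X_pow] at hq
  have hdvd (i : ℕ) : (X 0 : MvPolynomial (Fin 2) ℝ) ^ i ∣ q := by
    induction i with
    | zero => simp
    | succ i ih =>
      obtain ⟨r, hr⟩ := ih
      have hd := hdeg hr
      have htr : (interfaceTrace r).natDegree ≤ m - i :=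
        natDegree_interfaceTrace_le (by omega)
      have hz := LinearMap.congr_fun (congrFun h ⟨i, by omega⟩) ⟨_, Polynomial.mem_degreeLT_succ.2 htr⟩
      have hc : (if i = 0 then 1 else β) * (i.factorial : ℝ) ≠ 0 :=
        mul_ne_zero (by split_ifs <;> simp [hβ]) (by exact_mod_cast i.factorial_ne_zero)
      have hint : (if i = 0 then 1 else β) * (i.factorial : ℝ) *
          ∫ ξ in ξ₀..ξ₁, (interfaceTrace r).eval ξ * (interfaceTrace r).eval ξ = 0 := by
        rw [← intervalIntegral.integral_const_mul]
        refine Eq.trans ?_ hz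
        rw [interfaceMoments_apply]
        congr 1
        ext ξ
        simp only
        rw [hr, interfaceData_X_pow_mul hJ₀ hJ₁ hJ₂, eval_interfaceTrace]
        ring
      obtain ⟨s, rfl⟩ := X_zero_dvd_of_interfaceTrace_eq_zero
        (Polynomial.eq_zero_of_integral_mul_self hξ ((mul_eq_zero.1 hint).resolve_left hc))
      exact ⟨s, by rw [hr, pow_succ, mul_assoc]⟩
  obtain ⟨r, hr⟩ := hdvd (m + 1)
  have := hdeg hr
  omega

lemma bijective_interfaceMoments {m : ℕ} (hξ : ξ₀ < ξ₁) {β : ℝ} (hβ : β ≠ 0) :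
    Function.Bijective ((interfaceMoments ξ₀ ξ₁ hJ₀ hJ₁ hJ₂ m β).domRestrict
      (restrictTotalDegree (Fin 2) ℝ m)) := by
  have (n : ℕ) : FiniteDimensional ℝ (Polynomial.degreeLT ℝ n) :=
    (Polynomial.degreeLTEquiv ℝ n).symm.finiteDimensional
  have hinj : Function.Injective ((interfaceMoments ξ₀ ξ₁ hJ₀ hJ₁ hJ₂ m β).domRestrict
      (restrictTotalDegree (Fin 2) ℝ m)) := by
    rw [injective_iff_map_eq_zero]
    intro q hq
    exact Subtype.ext (eq_zero_of_interfaceMoments_eq_zero hJ₀ hJ₁ hJ₂ hξ hβ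
      ((mem_restrictTotalDegree _ _ _).1 q.2) hq)
  refine ⟨hinj, (LinearMap.injective_iff_surjective_of_finrank_eq_finrank ?_).1 hinj⟩
  rw [finrank_restrictTotalDegree_fin_two, Module.finrank_pi_fintype]
  refine Finset.sum_congr rfl fun i _ => ?_
  rw [Subspace.dual_finrank_eq, (Polynomial.degreeLTEquiv ℝ _).finrank_eq, Module.finrank_fin_fun]

end moments

/-- The set `𝒱` of pairs `(q⁻, q⁺)` of bivariate polynomials of total degree at
most `m` satisfying the Frenet interface jump conditions is a linear subspace of
`ℙ_m × ℙ_m`, the projection `(q⁻, q⁺) ↦ q⁻` restricted to `𝒱` is a linear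
isomorphism onto `ℙ_m`, and `𝒱` has dimension `(m+1)(m+2)/2`. -/
theorem stmt_4 (m : ℕ) (hm : 1 ≤ m) (ξ₀ ξ₁ : ℝ) (hξ : ξ₀ < ξ₁)
    (βm βp : ℝ) (hβm : 0 < βm) (hβp : 0 < βp)
    (J₀ J₁ J₂ : ℝ → ℝ → ℝ)
    (hJ₀ : ContDiff ℝ (⊤ : ℕ∞) (Function.uncurry J₀))
    (hJ₁ : ContDiff ℝ (⊤ : ℕ∞) (Function.uncurry J₁))
    (hJ₂ : ContDiff ℝ (⊤ : ℕ∞) (Function.uncurry J₂)) :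
    ∃ V : Submodule ℝ (MvPolynomial (Fin 2) ℝ × MvPolynomial (Fin 2) ℝ),
      (V : Set (MvPolynomial (Fin 2) ℝ × MvPolynomial (Fin 2) ℝ)) =
        {pq | pq.1.totalDegree ≤ m ∧ pq.2.totalDegree ≤ m ∧
          JumpConds m ξ₀ ξ₁ βm βp J₀ J₁ J₂ pq.1 pq.2} ∧
      (∃ e : V ≃ₗ[ℝ] MvPolynomial.restrictTotalDegree (Fin 2) ℝ m,
        ∀ x : V, (e x : MvPolynomial (Fin 2) ℝ) =
          (x : MvPolynomial (Fin 2) ℝ × MvPolynomial (Fin 2) ℝ).1) ∧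
      Module.finrank ℝ V = (m + 1) * (m + 2) / 2 := by
  let T := fun β => interfaceMoments ξ₀ ξ₁ hJ₀ hJ₁ hJ₂ m β
  let P := restrictTotalDegree (Fin 2) ℝ m
  let V : Submodule ℝ (MvPolynomial (Fin 2) ℝ × MvPolynomial (Fin 2) ℝ) :=
    P.prod P ⊓ LinearMap.eqLocus (T βp ∘ₗ LinearMap.snd ℝ _ _) (T βm ∘ₗ LinearMap.fst ℝ _ _)
  have hV (x : MvPolynomial (Fin 2) ℝ × MvPolynomial (Fin 2) ℝ) :
      x ∈ V ↔ (x.1 ∈ P ∧ x.2 ∈ P) ∧ T βp x.2 = T βm x.1 := Iff.rfl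
  let f : V →ₗ[ℝ] P :=
    (LinearMap.fst ℝ _ _ ∘ₗ V.subtype).codRestrict P fun x => ((hV x).1 x.2).1.1
  have hb := bijective_interfaceMoments (m := m) hJ₀ hJ₁ hJ₂ hξ hβp.ne'
  have hf : Function.Bijective f := by
    constructor
    · rintro ⟨x, hx⟩ ⟨y, hy⟩ hxy
      have h1 : x.1 = y.1 := congrArg Subtype.val hxy
      rw [hV] at hx hy
      have h2 := @hb.1 ⟨x.2, hx.1.2⟩ ⟨y.2, hy.1.2⟩
        (hx.2.trans ((congrArg (T βm) h1).trans hy.2.symm))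
      exact Subtype.ext (Prod.ext h1 (congrArg Subtype.val h2))
    · intro q
      obtain ⟨p, hp⟩ := hb.2 (T βm q)
      exact ⟨⟨(q, p), (hV _).2 ⟨⟨q.2, p.2⟩, hp⟩⟩, rfl⟩
  let e := LinearEquiv.ofBijective f hf
  refine ⟨V, ?_, ⟨e, fun x => rfl⟩, ?_⟩
  · ext x
    rw [SetLike.mem_coe, hV, mem_restrictTotalDegree, mem_restrictTotalDegree, and_assoc]
    exact and_congr_right fun h1 => and_congr_right fun h2 =>
      (jumpConds_iff hJ₀ hJ₁ hJ₂ hm hξ βm βp h1 h2).symm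
  · rw [e.finrank_eq, finrank_restrictTotalDegree_fin_two, sum_fin_sub_add_one]
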